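/- The two information orderings ⊑L+ and ⊑L− contradict each other on Δ³: for the distinct points x = (3/5, 1/5, 1/5) and y = (1/2, 1/3, 1/6) in Δ³ one has y ⊑L+ x and x ⊑L− y. In particular, there exist two information orderings ⊑₁, ⊑₂ on Δ³ and points x ≠ y with y ⊑₁ x and x ⊑₂ y, so the axioms of an information ordering do not determine a unique order for n = 3. -/

import Mathlib

/-- `x` is a point of the probability simplex `Δⁿ`. -/
def IsDist {n : ℕ} (x : Fin n → ℝ) : Prop :=
  (∀ k, 0 ≤ x k) ∧ ∑ k, x k = 1

/-- `x⁺`, the largest coordinate of `x`. -/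
noncomputable def maxCoord {n : ℕ} (x : Fin n → ℝ) : ℝ :=
  sSup (Set.range x)

/-- The renormalised Löwner order `⊑L+`. -/
def LowPlus {n : ℕ} (x y : Fin n → ℝ) : Prop :=
  ∀ k, maxCoord x * y k ≤ maxCoord y * x k

/-- `x⁻`, the smallest nonzero coordinate of `x`. -/
noncomputable def minPos {n : ℕ} (x : Fin n → ℝ) : ℝ :=
  sInf {a : ℝ | (∃ k, x k = a) ∧ a ≠ 0}

/-- The renormalised Löwner order `⊑L−`. -/
def LowMinus {n : ℕ} (x y : Fin n → ℝ) : Prop :=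
  {k | x k = 0} ⊆ {k | y k = 0} ∧
  ((∃ k, y k = 0 ∧ x k = minPos x) ∨
   ({k | x k = 0} = {k | y k = 0} ∧
     ∀ k, x k ≠ 0 → x k * minPos y ≤ y k * minPos x))

/-- `r` is an information ordering on `Δⁿ`: a partial order on `Δⁿ` which is permutation
invariant, allows mixing, has the uniform distribution as least element, and in which every
element lies below some pointed distribution `⊤ᵢ`, each `⊤ᵢ` being maximal. -/
def IsInfoOrder {n : ℕ} (r : (Fin n → ℝ) → (Fin n → ℝ) → Prop) : Prop :=
  (∀ x, IsDist x → r x x) ∧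
  (∀ x y z, IsDist x → IsDist y → IsDist z → r x y → r y z → r x z) ∧
  (∀ x y, IsDist x → IsDist y → r x y → r y x → x = y) ∧
  (∀ x y, IsDist x → IsDist y → ∀ σ : Equiv.Perm (Fin n), r x y → r (x ∘ σ) (y ∘ σ)) ∧
  (∀ x y, IsDist x → IsDist y → r x y → ∀ t ∈ Set.Icc (0:ℝ) 1,
    r x (fun k => (1 - t) * x k + t * y k) ∧ r (fun k => (1 - t) * x k + t * y k) y) ∧
  (∀ x, IsDist x → r (fun _ => (1 : ℝ) / n) x) ∧
  (∀ x, IsDist x → ∃ i, r x (fun k => if k = i then (1 : ℝ) else 0)) ∧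
  (∀ (i : Fin n) y, IsDist y → r (fun k => if k = i then (1 : ℝ) else 0) y →
    y = fun k => if k = i then (1 : ℝ) else 0)

theorem IsDist.pos {n : ℕ} {x : Fin n → ℝ} (hx : IsDist x) : ∃ k, 0 < x k := by
  by_contra! h
  have h1 := hx.2
  have h2 : ∑ k, x k ≤ 0 := Finset.sum_nonpos fun k _ => h k
  linarith

theorem IsDist.mix {n : ℕ} {x y : Fin n → ℝ} (hx : IsDist x) (hy : IsDist y) {t : ℝ}
    (ht : t ∈ Set.Icc (0 : ℝ) 1) : IsDist fun k => (1 - t) * x k + t * y k := by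
  refine ⟨fun k => ?_, ?_⟩
  · have h1 : 0 ≤ 1 - t := by linarith [ht.2]
    exact add_nonneg (mul_nonneg h1 (hx.1 k)) (mul_nonneg ht.1 (hy.1 k))
  · rw [Finset.sum_add_distrib, ← Finset.mul_sum, ← Finset.mul_sum, hx.2, hy.2]
    ring

/-- A distribution vanishing outside `i` is the point mass at `i`. -/
theorem IsDist.eq_pure {n : ℕ} {x : Fin n → ℝ} (hx : IsDist x) {i : Fin n}
    (h : ∀ k, k ≠ i → x k = 0) : x = fun k => if k = i then (1 : ℝ) else 0 := by
  have h1 := hx.2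
  rw [Finset.sum_eq_single i (fun k _ hk => h k hk) (by simp)] at h1
  funext k
  by_cases hk : k = i
  · simp [hk, h1]
  · simp [hk, h k hk]

theorem IsDist.eq_of_mul_eq {n : ℕ} {x y : Fin n → ℝ} (hx : IsDist x) (hy : IsDist y)
    {a b : ℝ} (ha : 0 < a) (h : ∀ k, a * x k = b * y k) : x = y := by
  have hab : a = b := by
    have hs : ∑ k, a * x k = ∑ k, b * y k := Finset.sum_congr rfl fun k _ => h k
    rw [← Finset.mul_sum, ← Finset.mul_sum, hx.2, hy.2] at hs
    linarith
  subst hab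
  funext k
  exact mul_left_cancel₀ ha.ne' (h k)

theorem isDist_pure {n : ℕ} (i : Fin n) :
    IsDist (fun k : Fin n => if k = i then (1 : ℝ) else 0) := by
  refine ⟨fun k => ?_, by simp⟩
  dsimp only
  split_ifs <;> norm_num

theorem le_maxCoord {n : ℕ} (x : Fin n → ℝ) (k : Fin n) : x k ≤ maxCoord x :=
  le_csSup (Set.finite_range x).bddAbove ⟨k, rfl⟩

theorem maxCoord_eq {n : ℕ} {x : Fin n → ℝ} {a : ℝ} (k : Fin n) (hk : x k = a)
    (h : ∀ j, x j ≤ a) : maxCoord x = a :=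
  IsGreatest.csSup_eq ⟨⟨k, hk⟩, by rintro _ ⟨j, rfl⟩; exact h j⟩

theorem IsDist.exists_eq_maxCoord {n : ℕ} {x : Fin n → ℝ} (hx : IsDist x) :
    ∃ k, x k = maxCoord x :=
  Set.Nonempty.csSup_mem (hx.pos.elim fun k _ => ⟨x k, Set.mem_range_self k⟩) (Set.finite_range x)

theorem IsDist.maxCoord_pos {n : ℕ} {x : Fin n → ℝ} (hx : IsDist x) : 0 < maxCoord x :=
  hx.pos.elim fun k hk => hk.trans_le (le_maxCoord x k)

theorem maxCoord_comp_perm {n : ℕ} (x : Fin n → ℝ) (σ : Equiv.Perm (Fin n)) :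
    maxCoord (x ∘ σ) = maxCoord x := by
  rw [maxCoord, maxCoord, σ.surjective.range_comp]

theorem minPos_eq {n : ℕ} {x : Fin n → ℝ} {a : ℝ} (k : Fin n) (hk : x k = a) (ha : a ≠ 0)
    (h : ∀ j, x j ≠ 0 → a ≤ x j) : minPos x = a :=
  IsLeast.csInf_eq ⟨⟨⟨k, hk⟩, ha⟩, by rintro _ ⟨⟨j, rfl⟩, hj⟩; exact h j hj⟩

theorem minPos_set_finite {n : ℕ} (x : Fin n → ℝ) :
    {a : ℝ | (∃ k, x k = a) ∧ a ≠ 0}.Finite :=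
  (Set.finite_range x).subset fun _ ha => ha.1

theorem minPos_le {n : ℕ} (x : Fin n → ℝ) {k : Fin n} (hk : x k ≠ 0) : minPos x ≤ x k :=
  csInf_le (minPos_set_finite x).bddBelow ⟨⟨k, rfl⟩, hk⟩

theorem IsDist.minPos_mem {n : ℕ} {x : Fin n → ℝ} (hx : IsDist x) :
    (∃ k, x k = minPos x) ∧ minPos x ≠ 0 :=
  Set.Nonempty.csInf_mem (s := {a : ℝ | (∃ k, x k = a) ∧ a ≠ 0})
    (hx.pos.elim fun k hk => ⟨x k, ⟨k, rfl⟩, hk.ne'⟩) (minPos_set_finite x)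

theorem IsDist.minPos_pos {n : ℕ} {x : Fin n → ℝ} (hx : IsDist x) : 0 < minPos x := by
  obtain ⟨⟨k, hk⟩, h0⟩ := hx.minPos_mem
  exact lt_of_le_of_ne (hk ▸ hx.1 k) h0.symm

theorem minPos_comp_perm {n : ℕ} (x : Fin n → ℝ) (σ : Equiv.Perm (Fin n)) :
    minPos (x ∘ σ) = minPos x := by
  have h : ∀ a, (∃ k, (x ∘ σ) k = a) ↔ ∃ k, x k = a := fun a =>
    σ.surjective.exists (p := fun k => x k = a) |>.symm
  simp only [minPos, h]

theorem LowPlus.exists_common_max {n : ℕ} {x y : Fin n → ℝ} (hy : IsDist y)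
    (h : LowPlus x y) : ∃ k, x k = maxCoord x ∧ y k = maxCoord y := by
  obtain ⟨k, hk⟩ := hy.exists_eq_maxCoord
  refine ⟨k, le_antisymm (le_maxCoord x k) ?_, hk⟩
  have h1 := h k
  rw [hk, mul_comm] at h1
  exact le_of_mul_le_mul_left h1 hy.maxCoord_pos

theorem LowPlus.maxCoord_mix {n : ℕ} {x y : Fin n → ℝ} (hy : IsDist y) (h : LowPlus x y)
    {t : ℝ} (ht : t ∈ Set.Icc (0 : ℝ) 1) :
    maxCoord (fun k => (1 - t) * x k + t * y k) = (1 - t) * maxCoord x + t * maxCoord y := by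
  obtain ⟨k, hxk, hyk⟩ := h.exists_common_max hy
  refine maxCoord_eq k (by simp only [hxk, hyk]) fun j => ?_
  have h1 : 0 ≤ 1 - t := by linarith [ht.2]
  exact add_le_add (mul_le_mul_of_nonneg_left (le_maxCoord x j) h1)
    (mul_le_mul_of_nonneg_left (le_maxCoord y j) ht.1)

theorem lowPlus_isInfoOrder (n : ℕ) : IsInfoOrder (LowPlus (n := n)) := by
  refine ⟨fun x _ k => le_rfl, ?_, ?_, ?_, ?_, ?_, ?_, ?_⟩
  · intro x y z hx hy hz hxy hyz k
    refine le_of_mul_le_mul_left ?_ hy.maxCoord_pos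
    have h1 := mul_le_mul_of_nonneg_left (hyz k) hx.maxCoord_pos.le
    have h2 := mul_le_mul_of_nonneg_left (hxy k) hz.maxCoord_pos.le
    linarith
  · intro x y hx hy hxy hyx
    exact hx.eq_of_mul_eq hy hy.maxCoord_pos fun k => le_antisymm (hyx k) (hxy k)
  · intro x y _ _ σ h k
    rw [maxCoord_comp_perm, maxCoord_comp_perm]
    exact h (σ k)
  · intro x y hx hy h t ht
    have h1 : 0 ≤ 1 - t := by linarith [ht.2]
    constructor <;> intro k <;> rw [h.maxCoord_mix hy ht]
    · linarith [mul_le_mul_of_nonneg_left (h k) ht.1]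
    · linarith [mul_le_mul_of_nonneg_left (h k) h1]
  · intro x hx k
    rw [maxCoord_eq (x := fun _ : Fin n => (1 : ℝ) / n) k rfl fun _ => le_rfl, mul_comm]
    exact mul_le_mul_of_nonneg_right (le_maxCoord x k) (by positivity)
  · intro x hx
    obtain ⟨i, hi⟩ := hx.exists_eq_maxCoord
    refine ⟨i, fun k => ?_⟩
    have hm : maxCoord (fun k : Fin n => if k = i then (1 : ℝ) else 0) = 1 :=
      maxCoord_eq i (by simp) fun j => by split_ifs <;> norm_num
    rw [hm]
    by_cases hk : k = i
    · simp [hk, hi]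
    · simp [hk, hx.1 k]
  · intro i y hy h
    refine hy.eq_pure fun k hk => le_antisymm ?_ (hy.1 k)
    have h1 := h k
    simp only [if_neg hk, mul_zero] at h1
    exact nonpos_of_mul_nonpos_right h1 (isDist_pure i).maxCoord_pos

theorem IsDist.minPos_mix {n : ℕ} {x y : Fin n → ℝ} (hx : IsDist x) (hy : IsDist y)
    {k : Fin n} (hxk : x k = minPos x) {b : ℝ} (hyk : y k = b)
    (hb : ∀ j, x j ≠ 0 → b ≤ y j) (hz : ∀ j, x j = 0 → y j = 0)
    {t : ℝ} (h0 : 0 ≤ t) (h1 : t < 1) :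
    minPos (fun k => (1 - t) * x k + t * y k) = (1 - t) * minPos x + t * b := by
  have h1' : 0 < 1 - t := by linarith
  refine minPos_eq k (by simp only [hxk, hyk]) ?_ fun j hj => ?_
  · have := mul_pos h1' hx.minPos_pos
    have := mul_nonneg h0 (hyk ▸ hy.1 k)
    linarith
  · have hxj : x j ≠ 0 := fun h => hj (by simp [h, hz j h])
    exact add_le_add (mul_le_mul_of_nonneg_left (minPos_le x hxj) h1'.le)
      (mul_le_mul_of_nonneg_left (hb j hxj) h0)

/-- In the second case of `LowMinus`, a minimal nonzero coordinate of `y` is one of `x`. -/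
theorem eq_minPos_of_mul_le {n : ℕ} {x y : Fin n → ℝ} (hy : IsDist y) {k : Fin n}
    (hxk : x k ≠ 0) (hyk : y k = minPos y) (h : x k * minPos y ≤ y k * minPos x) :
    x k = minPos x := by
  rw [hyk, mul_comm] at h
  exact le_antisymm (le_of_mul_le_mul_left h hy.minPos_pos) (minPos_le x hxk)

theorem lowMinus_refl {n : ℕ} (x : Fin n → ℝ) : LowMinus x x :=
  ⟨subset_rfl, Or.inr ⟨rfl, fun _ _ => le_rfl⟩⟩

theorem LowMinus.trans {n : ℕ} {x y z : Fin n → ℝ} (hx : IsDist x) (hy : IsDist y)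
    (hz : IsDist z) (hxy : LowMinus x y) (hyz : LowMinus y z) : LowMinus x z := by
  refine ⟨hxy.1.trans hyz.1, ?_⟩
  rcases hxy.2 with ⟨k, hyk, hxk⟩ | ⟨he, hle⟩
  · exact Or.inl ⟨k, hyz.1 hyk, hxk⟩
  have hs : ∀ k, x k = 0 ↔ y k = 0 := fun k => Set.ext_iff.1 he k
  rcases hyz.2 with ⟨k, hzk, hyk⟩ | ⟨he', hle'⟩
  · have hyk0 : y k ≠ 0 := hyk ▸ hy.minPos_pos.ne'
    have hxk0 : x k ≠ 0 := fun h => hyk0 ((hs k).1 h)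
    exact Or.inl ⟨k, hzk, eq_minPos_of_mul_le hy hxk0 hyk (hle k hxk0)⟩
  · refine Or.inr ⟨he.trans he', fun k hk => ?_⟩
    refine le_of_mul_le_mul_left ?_ hy.minPos_pos
    have h1 := mul_le_mul_of_nonneg_left (hle k hk) hz.minPos_pos.le
    have h2 := mul_le_mul_of_nonneg_left (hle' k fun h => hk ((hs k).2 h)) hx.minPos_pos.le
    linarith

theorem LowMinus.antisymm {n : ℕ} {x y : Fin n → ℝ} (hx : IsDist x) (hy : IsDist y)
    (hxy : LowMinus x y) (hyx : LowMinus y x) : x = y := by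
  rcases hxy.2 with ⟨k, hyk, hxk⟩ | ⟨he, hle⟩
  · exact absurd (hxk.symm.trans (hyx.1 hyk)) hx.minPos_pos.ne'
  rcases hyx.2 with ⟨k, hxk, hyk⟩ | ⟨-, hle'⟩
  · exact absurd (hyk.symm.trans (hxy.1 hxk)) hy.minPos_pos.ne'
  have hs : ∀ k, x k = 0 ↔ y k = 0 := fun k => Set.ext_iff.1 he k
  refine hx.eq_of_mul_eq hy (b := minPos x) hy.minPos_pos fun k => ?_
  by_cases hk : x k = 0
  · rw [hk, (hs k).1 hk, mul_zero, mul_zero]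
  · linarith [hle k hk, hle' k fun h => hk ((hs k).2 h)]

theorem LowMinus.comp_perm {n : ℕ} {x y : Fin n → ℝ} (h : LowMinus x y)
    (σ : Equiv.Perm (Fin n)) : LowMinus (x ∘ σ) (y ∘ σ) := by
  rw [LowMinus, minPos_comp_perm, minPos_comp_perm]
  refine ⟨fun k hk => h.1 hk, ?_⟩
  rcases h.2 with ⟨k, hyk, hxk⟩ | ⟨he, hle⟩
  · exact Or.inl ⟨σ.symm k, by simpa using hyk, by simpa using hxk⟩
  · exact Or.inr ⟨Set.ext fun k => Set.ext_iff.1 he (σ k), fun k hk => hle (σ k) hk⟩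

theorem LowMinus.mix {n : ℕ} {x y : Fin n → ℝ} (hx : IsDist x) (hy : IsDist y)
    (h : LowMinus x y) {t : ℝ} (ht : t ∈ Set.Icc (0 : ℝ) 1) :
    LowMinus x (fun k => (1 - t) * x k + t * y k) ∧
      LowMinus (fun k => (1 - t) * x k + t * y k) y := by
  rcases ht.2.eq_or_lt with rfl | h1
  · simpa using ⟨h, lowMinus_refl y⟩
  have h1' : 0 < 1 - t := by linarith
  have hz : ∀ j, x j = 0 → y j = 0 := fun j hj => h.1 hj
  have hm : ∀ j, (1 - t) * x j + t * y j = 0 ↔ x j = 0 := fun j => by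
    refine ⟨fun hj => ?_, fun hj => by simp [hj, hz j hj]⟩
    have h2 := mul_nonneg ht.1 (hy.1 j)
    have h3 := mul_nonneg h1'.le (hx.1 j)
    exact (mul_eq_zero.1 (show (1 - t) * x j = 0 by linarith)).resolve_left h1'.ne'
  have hs : {k | x k = 0} = {k | (1 - t) * x k + t * y k = 0} :=
    Set.ext fun k => (hm k).symm
  rcases h.2 with ⟨k, hyk, hxk⟩ | ⟨he, hle⟩
  · have hmin := hx.minPos_mix hy hxk hyk (fun j _ => hy.1 j) hz ht.1 h1
    refine ⟨⟨hs.subset, Or.inr ⟨hs, fun j _ => ?_⟩⟩, hs ▸ h.1, Or.inl ⟨k, hyk, ?_⟩⟩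
    · rw [hmin]
      linarith [mul_nonneg (mul_nonneg ht.1 (hy.1 j)) hx.minPos_pos.le]
    · rw [hmin]
      simp only [hxk, hyk]
  · have hs' : ∀ k, x k = 0 ↔ y k = 0 := fun k => Set.ext_iff.1 he k
    obtain ⟨⟨k, hyk⟩, hy0⟩ := hy.minPos_mem
    have hxk0 : x k ≠ 0 := fun h => hy0 (hyk ▸ hz k h)
    have hxk := eq_minPos_of_mul_le hy hxk0 hyk (hle k hxk0)
    have hmin := hx.minPos_mix hy hxk hyk
      (fun j hj => minPos_le y fun h => hj ((hs' j).2 h)) hz ht.1 h1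
    refine ⟨⟨hs.subset, Or.inr ⟨hs, fun j hj => ?_⟩⟩, hs ▸ h.1,
      Or.inr ⟨hs.symm.trans he, fun j hj => ?_⟩⟩
    · rw [hmin]
      linarith [mul_le_mul_of_nonneg_left (hle j hj) ht.1]
    · rw [hmin]
      have hj' : x j ≠ 0 := fun h => hj ((hm j).2 h)
      linarith [mul_le_mul_of_nonneg_left (hle j hj') h1'.le]

theorem IsDist.uniform_lowMinus {n : ℕ} {x : Fin n → ℝ} (hx : IsDist x) :
    LowMinus (fun _ => (1 : ℝ) / n) x := by
  obtain ⟨i, -⟩ := hx.pos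
  have hn : (0 : ℝ) < 1 / n := by
    have : 0 < n := i.pos
    positivity
  have hmin : minPos (fun _ : Fin n => (1 : ℝ) / n) = 1 / n :=
    minPos_eq i rfl hn.ne' fun _ _ => le_rfl
  refine ⟨fun k hk => absurd hk hn.ne', ?_⟩
  rw [hmin]
  by_cases h : ∃ k, x k = 0
  · exact Or.inl (h.imp fun k hk => ⟨hk, rfl⟩)
  · push Not at h
    refine Or.inr ⟨Set.ext fun k => iff_of_false hn.ne' (h k), fun k _ => ?_⟩
    rw [mul_comm]
    exact mul_le_mul_of_nonneg_right (minPos_le x (h k)) hn.le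

theorem IsDist.exists_lowMinus_pure {n : ℕ} {x : Fin n → ℝ} (hx : IsDist x) :
    ∃ i, LowMinus x (fun k => if k = i then (1 : ℝ) else 0) := by
  obtain ⟨⟨k, hk⟩, h0⟩ := hx.minPos_mem
  by_cases h : ∃ i, i ≠ k ∧ x i ≠ 0
  · obtain ⟨i, hik, hi⟩ := h
    exact ⟨i, fun j hj => if_neg fun hji : j = i => hi (hji ▸ hj),
      Or.inl ⟨k, if_neg hik.symm, hk⟩⟩
  · push Not at h
    exact ⟨k, hx.eq_pure h ▸ lowMinus_refl x⟩

theorem lowMinus_isInfoOrder (n : ℕ) : IsInfoOrder (LowMinus (n := n)) := by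
  refine ⟨fun x _ => lowMinus_refl x, fun x y z hx hy hz => LowMinus.trans hx hy hz,
    fun x y hx hy => LowMinus.antisymm hx hy, fun x y _ _ σ h => h.comp_perm σ,
    fun x y hx hy h t ht => h.mix hx hy ht, fun x hx => hx.uniform_lowMinus,
    fun x hx => hx.exists_lowMinus_pure, fun i y hy h => ?_⟩
  exact hy.eq_pure fun k hk => h.1 (if_neg hk)

/-- The orderings `⊑L+` and `⊑L−` contradict each other on `Δ³`: for
`x = (3/5, 1/5, 1/5)` and `y = (1/2, 1/3, 1/6)` one has `y ⊑L+ x` and `x ⊑L− y`; in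
particular there exist two information orderings `⊑₁`, `⊑₂` on `Δ³` and points `x ≠ y` with
`y ⊑₁ x` and `x ⊑₂ y`. -/
theorem infoOrder_not_unique :
    (IsDist (![3/5, 1/5, 1/5] : Fin 3 → ℝ) ∧ IsDist (![1/2, 1/3, 1/6] : Fin 3 → ℝ) ∧
      (![3/5, 1/5, 1/5] : Fin 3 → ℝ) ≠ ![1/2, 1/3, 1/6] ∧
      LowPlus (![1/2, 1/3, 1/6] : Fin 3 → ℝ) ![3/5, 1/5, 1/5] ∧
      LowMinus (![3/5, 1/5, 1/5] : Fin 3 → ℝ) ![1/2, 1/3, 1/6]) ∧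
    ∃ r₁ r₂ : (Fin 3 → ℝ) → (Fin 3 → ℝ) → Prop,
      IsInfoOrder r₁ ∧ IsInfoOrder r₂ ∧
      ∃ x y : Fin 3 → ℝ, IsDist x ∧ IsDist y ∧ x ≠ y ∧ r₁ y x ∧ r₂ x y := by
  have hx : IsDist (![3/5, 1/5, 1/5] : Fin 3 → ℝ) := by
    refine ⟨fun k => by fin_cases k <;> norm_num, ?_⟩
    simp [Fin.sum_univ_three]
    norm_num
  have hy : IsDist (![1/2, 1/3, 1/6] : Fin 3 → ℝ) := by
    refine ⟨fun k => by fin_cases k <;> norm_num, ?_⟩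
    simp [Fin.sum_univ_three]
    norm_num
  have hne : (![3/5, 1/5, 1/5] : Fin 3 → ℝ) ≠ ![1/2, 1/3, 1/6] := fun h => by
    have h0 := congrFun h 0
    norm_num at h0
  have hp : LowPlus (![1/2, 1/3, 1/6] : Fin 3 → ℝ) ![3/5, 1/5, 1/5] := by
    have h1 : maxCoord (![1/2, 1/3, 1/6] : Fin 3 → ℝ) = 1/2 :=
      maxCoord_eq 0 rfl fun j => by fin_cases j <;> norm_num
    have h2 : maxCoord (![3/5, 1/5, 1/5] : Fin 3 → ℝ) = 3/5 :=
      maxCoord_eq 0 rfl fun j => by fin_cases j <;> norm_num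
    intro k
    rw [h1, h2]
    fin_cases k <;> norm_num
  have hm : LowMinus (![3/5, 1/5, 1/5] : Fin 3 → ℝ) ![1/2, 1/3, 1/6] := by
    have h1 : minPos (![1/2, 1/3, 1/6] : Fin 3 → ℝ) = 1/6 :=
      minPos_eq 2 rfl (by norm_num) fun j _ => by fin_cases j <;> norm_num
    have h2 : minPos (![3/5, 1/5, 1/5] : Fin 3 → ℝ) = 1/5 :=
      minPos_eq 2 rfl (by norm_num) fun j _ => by fin_cases j <;> norm_num
    have hs : {k | (![3/5, 1/5, 1/5] : Fin 3 → ℝ) k = 0} =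
        {k | (![1/2, 1/3, 1/6] : Fin 3 → ℝ) k = 0} := by
      ext k
      fin_cases k <;> norm_num
    refine ⟨hs.subset, Or.inr ⟨hs, fun k _ => ?_⟩⟩
    rw [h1, h2]
    fin_cases k <;> norm_num
  exact ⟨⟨hx, hy, hne, hp, hm⟩, LowPlus, LowMinus, lowPlus_isInfoOrder 3,
    lowMinus_isInfoOrder 3, _, _, hx, hy, hne, hp, hm⟩
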